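/- arXiv:2405.14229 — 2 statements merged into one kernel-verified Lean document; each statement's English description precedes it below -/
import Mathlib

section
/- Let A(t) = A₀B²₀(t)+A₁B²₁(t)+A₂B²₂(t) and Ã(s) = μA₀B²₀(s)+μλA₁B²₁(s)+μλ²A₂B²₂(s) be quadratic quaternion pre-images with μ, λ > 0. Then the tangent indicatrices t(u) = A(u)iA(u)*/(A(u)A(u)*) and t̃(s) = Ã(s)iÃ(s)*/(Ã(s)Ã(s)*) satisfy t̃(s) = t(ξ(s)) with ξ(s) = λs/((λ−1)s+1); in particular the two indicatrices have the same image on the unit sphere. -/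
noncomputable section

/-- Quadratic Bernstein polynomial `B²ᵢ(t)`. -/
def bern2 (i : ℕ) (t : ℝ) : ℝ := ((2 : ℕ).choose i : ℝ) * t ^ i * (1 - t) ^ (2 - i)

/-- If `Ã` is obtained from a quadratic quaternion pre-image `A` by scaling the Bézier
coefficients by `μ, μλ, μλ²` (`μ, λ > 0`), the two tangent indicatrices
`t = A i A*/(A A*)` are related by the linear rational reparameterization
`ξ(s) = λs/((λ−1)s+1)`; in particular they have the same image on the unit sphere. -/
theorem stmt_10 (i : Quaternion ℝ) (hire : i.re = 0) (hinorm : ‖i‖ = 1)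
    (A0 A1 A2 : Quaternion ℝ) (μ lam : ℝ) (hμ : 0 < μ) (hlam : 0 < lam)
    (s : ℝ) (hs : s ∈ Set.Icc (0 : ℝ) 1) :
    let A : ℝ → Quaternion ℝ := fun u => bern2 0 u • A0 + bern2 1 u • A1 + bern2 2 u • A2
    let Atilde : ℝ → Quaternion ℝ := fun u =>
      (μ * bern2 0 u) • A0 + (μ * lam * bern2 1 u) • A1 + (μ * lam ^ 2 * bern2 2 u) • A2
    let tang : (ℝ → Quaternion ℝ) → ℝ → Quaternion ℝ := fun B u =>
      (Quaternion.normSq (B u))⁻¹ • (B u * i * star (B u))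
    let ξ : ℝ := lam * s / ((lam - 1) * s + 1)
    tang Atilde s = tang A ξ := by
  intro A Atilde tang ξ
  obtain ⟨h0, h1⟩ := hs
  have hd : 0 < (lam - 1) * s + 1 := by
    rcases h0.eq_or_lt with h | h
    · rw [← h]; norm_num
    · nlinarith [mul_pos hlam h]
  have hd' := hd.ne'
  have key : Atilde s = (μ * ((lam - 1) * s + 1) ^ 2) • A ξ := by
    have hξ : 1 - ξ = (1 - s) / ((lam - 1) * s + 1) := by
      simp only [ξ]
      rw [eq_div_iff hd', sub_mul, div_mul_cancel₀ _ hd']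
      ring
    simp only [Atilde, A, smul_add, smul_smul, bern2, hξ]
    simp only [ξ]
    clear hξ
    clear_value A Atilde tang ξ
    generalize (lam - 1) * s + 1 = d at hd hd' ⊢
    congr 1
    · congr 1
      · congr 1
        norm_num
        field_simp
      · congr 1
        norm_num
        field_simp
    · congr 1
      norm_num
      field_simp
  have hc : 0 < μ * ((lam - 1) * s + 1) ^ 2 := by positivity
  generalize μ * ((lam - 1) * s + 1) ^ 2 = c at key hc
  have hc' := hc.ne'
  simp only [tang, key]
  rw [Quaternion.normSq_smul, Quaternion.star_smul, smul_mul_assoc, smul_mul_assoc,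
    mul_smul_comm, smul_smul, smul_smul]
  congr 1
  rw [mul_inv]
  field_simp
end
end

section
/- Let h_b, h_e be nonzero vectors with h_b × h_e ≠ 0 and angular distance γ ∈ (0,π), and fix a pure unit vector quaternion i. As A_b, A_e range over all quaternion square roots of h_b and h_e with respect to i, the vector h_m = A_b ⋆ A_e traces the ellipse h_m(φ) = sqrt(|h_b||h_e|)·( b(h_b,h_e)·cos φ + sin(γ/2)·n(h_b,h_e)·sin φ ), φ ∈ [0,2π); in particular the major semi-axis has direction b(h_b,h_e) and length sqrt(|h_b||h_e|), and the minor semi-axis has direction n(h_b,h_e) and length sin(γ/2)·sqrt(|h_b||h_e|). -/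
noncomputable section

/-- Cross product of pure vector quaternions: the vector part of `u * v`. -/
def crossQ (u v : Quaternion ℝ) : Quaternion ℝ := (u * v).im

/-- Euclidean dot product of quaternions. -/
def dotQ (u v : Quaternion ℝ) : ℝ := (u * star v).re


open Quaternion in
theorem aux_sq (u : Quaternion ℝ) (hre : u.re = 0) (hn : ‖u‖ = 1) : u * u = -1 := by
  have h : normSq u = 1 := by rw [Quaternion.normSq_eq_norm_mul_self, hn]; norm_num
  have hs : star u = -u := by
    rw [Quaternion.star_eq_neg]; exact hre
  have h2 := Quaternion.self_mul_star u
  rw [hs, h] at h2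
  have h3 : u * u = -(u * -u) := by noncomm_ring
  rw [h3, h2]; simp

open Quaternion in
theorem aux_star (u : Quaternion ℝ) (hre : u.re = 0) : star u = -u := by
  rw [Quaternion.star_eq_neg]; exact hre

open Quaternion in
theorem aux_comm (K U : Quaternion ℝ) (hre : U.re = 0) (hn : U * U = -1)
    (h : K * U = U * K) : ∃ x z : ℝ, K = x • (1 : Quaternion ℝ) + z • U := by
  refine ⟨K.re, K.imI * U.imI + K.imJ * U.imJ + K.imK * U.imK, ?_⟩
  have h0 := congrArg QuaternionAlgebra.re hn
  have h1 := congrArg QuaternionAlgebra.imI h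
  have h2 := congrArg QuaternionAlgebra.imJ h
  have h3 := congrArg QuaternionAlgebra.imK h
  simp [hre] at h0 h1 h2 h3
  ext <;> simp [hre]
  · linear_combination K.imI * h0 - (U.imK/2) * h2 + (U.imJ/2) * h3
  · linear_combination K.imJ * h0 - (U.imI/2) * h3 + (U.imK/2) * h1
  · linear_combination K.imK * h0 - (U.imJ/2) * h1 + (U.imI/2) * h2

open Quaternion in
/-- existence of unit square root -/
theorem aux_root (i V : Quaternion ℝ) (hire : i.re = 0) (hi : i * i = -1) (hV : V * V = -1) :
    ∃ Q : Quaternion ℝ, Q * i * star Q = V ∧ Q * star Q = 1 := by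
  have key : ∃ X : Quaternion ℝ, X * i + V * X ≠ 0 := by
    by_contra! hc
    have h1 := hc 1
    have hVi : V = -i := by
      rw [one_mul, mul_one] at h1
      exact (neg_eq_of_add_eq_zero_right h1).symm
    obtain ⟨X, x0, x1, x2, x3⟩ : ∃ X : Quaternion ℝ, X.re = 0 ∧ X.imI = 1 ∧ X.imJ = 0 ∧ X.imK = 0 :=
      ⟨⟨0, 1, 0, 0⟩, rfl, rfl, rfl, rfl⟩
    obtain ⟨Y, y0, y1, y2, y3⟩ : ∃ X : Quaternion ℝ, X.re = 0 ∧ X.imI = 0 ∧ X.imJ = 1 ∧ X.imK = 0 :=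
      ⟨⟨0, 0, 1, 0⟩, rfl, rfl, rfl, rfl⟩
    have hI := hc X
    have hJ := hc Y
    rw [hVi] at hI hJ
    have a1 := congrArg QuaternionAlgebra.imJ hI
    have a2 := congrArg QuaternionAlgebra.imK hI
    have a3 := congrArg QuaternionAlgebra.imK hJ
    have h0 := congrArg QuaternionAlgebra.re hi
    simp [hire, x0, x1, x2, x3, y0, y1, y2, y3] at a1 a2 a3 h0
    have b1 : i.imI = 0 := by linarith
    have b2 : i.imJ = 0 := by linarith
    have b3 : i.imK = 0 := by linarith
    rw [b1, b2, b3] at h0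
    norm_num at h0
  obtain ⟨X, hX⟩ := key
  set Y := X * i + V * X with hY
  have hYi : Y * i = V * Y := by
    have e1 : Y * i = X * (i * i) + V * X * i := by rw [hY]; noncomm_ring
    have e2 : V * Y = V * X * i + (V * V) * X := by rw [hY]; noncomm_ring
    rw [e1, e2, hi, hV]; noncomm_ring
  have hN : ‖Y‖ ≠ 0 := norm_ne_zero_iff.mpr hX
  have hQ : (‖Y‖⁻¹ • Y) * star (‖Y‖⁻¹ • Y) = (1 : Quaternion ℝ) := by
    rw [Quaternion.self_mul_star, Quaternion.normSq_eq_norm_mul_self, norm_smul]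
    simp [hN]
  refine ⟨‖Y‖⁻¹ • Y, ?_, hQ⟩
  rw [smul_mul_assoc, hYi, ← mul_smul_comm, mul_assoc, hQ, mul_one]

open Quaternion in
theorem aux_norm (i P U : Quaternion ℝ) (hi : ‖i‖ = 1) (h : P * i * star P = U) :
    ‖P‖ * ‖P‖ = ‖U‖ := by
  rw [← h]; simp [hi]

open Quaternion in
theorem aux_unit_mul (P : Quaternion ℝ) (h : ‖P‖ = 1) : P * star P = 1 ∧ star P * P = 1 := by
  rw [Quaternion.self_mul_star, Quaternion.star_mul_self, Quaternion.normSq_eq_norm_mul_self, h]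
  simp

open Quaternion in
theorem aux_norm_eq (P : Quaternion ℝ) (h : P * star P = 1) : ‖P‖ = 1 := by
  have h2 := congrArg norm h
  rw [norm_mul, norm_star, norm_one] at h2
  nlinarith [norm_nonneg P]

open Quaternion in
/-- half the symmetrised product is the vector part of `U * W` -/
theorem aux_half (i P Q U : Quaternion ℝ) (hire : i.re = 0) (hP : star P * P = 1)
    (h : P * i * star P = U) :
    (1 / 2 : ℝ) • (P * i * star Q + Q * i * star P) = (U * (P * star Q)).im := by
  have e1 : U * (P * star Q) = P * i * star Q := by
    rw [← h]
    calc P * i * star P * (P * star Q) = P * i * (star P * P) * star Q := by noncomm_ring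
      _ = _ := by rw [hP, mul_one]
  have e2 : Q * i * star P = - star (P * i * star Q) := by
    rw [star_mul, star_mul, star_star, aux_star i hire]; noncomm_ring
  rw [e1, e2]
  ext <;> simp <;> ring

open Quaternion in
theorem aux_W (U V W : Quaternion ℝ) (hUre : U.re = 0) (hVre : V.re = 0)
    (hU : U * U = -1) (hV : V * V = -1) (hUV : U + V ≠ 0) (hW : W * V = U * W) :
    ∃ x z : ℝ, W = (x • (1 : Quaternion ℝ) + z • U) * (U + V) := by
  have hs : (U + V) * V = U * (U + V) := by rw [add_mul, mul_add, hU, hV, add_comm]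
  have hs' : V * (U + V)⁻¹ = (U + V)⁻¹ * U := by
    calc V * (U + V)⁻¹ = (U + V)⁻¹ * ((U + V) * V) * (U + V)⁻¹ := by
          rw [← mul_assoc, inv_mul_cancel₀ hUV, one_mul]
      _ = _ := by rw [hs, mul_assoc, mul_assoc, mul_inv_cancel₀ hUV, mul_one]
  obtain ⟨x, z, h⟩ := aux_comm (W * (U + V)⁻¹) U hUre hU (by
    rw [mul_assoc, ← hs', ← mul_assoc, hW, mul_assoc])
  refine ⟨x, z, ?_⟩
  rw [← h, mul_assoc, inv_mul_cancel₀ hUV, mul_one]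

open Quaternion in
theorem aux_im (U V : Quaternion ℝ) (hUre : U.re = 0) (hVre : V.re = 0)
    (hU : U * U = -1) (x z : ℝ) :
    (U * ((x • (1 : Quaternion ℝ) + z • U) * (U + V))).im
      = (-z) • (U + V) + x • (U * V).im := by
  have e : U * ((x • (1 : Quaternion ℝ) + z • U) * (U + V))
      = x • (U * U) + x • (U * V) + z • ((U * U) * (U + V)) := by
    simp only [add_mul, mul_add, smul_mul_assoc, mul_smul_comm, one_mul, mul_assoc, smul_add]
    abel
  rw [e, hU]
  ext <;> simp [hUre, hVre]
  all_goals ring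

open Quaternion in
theorem aux_normK (U : Quaternion ℝ) (hUre : U.re = 0) (hU : ‖U‖ = 1) (x z : ℝ) :
    ‖x • (1 : Quaternion ℝ) + z • U‖ ^ 2 = x ^ 2 + z ^ 2 := by
  have h : normSq U = 1 := by rw [Quaternion.normSq_eq_norm_mul_self, hU]; norm_num
  rw [sq, ← Quaternion.normSq_eq_norm_mul_self]
  rw [Quaternion.normSq_def'] at h ⊢
  simp [hUre] at h ⊢
  linear_combination z ^ 2 * h

/-- unit case -/
theorem aux_core (i U V : Quaternion ℝ) (hire : i.re = 0) (hinorm : ‖i‖ = 1)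
    (hUre : U.re = 0) (hVre : V.re = 0) (hU1 : ‖U‖ = 1) (hV1 : ‖V‖ = 1) (hUV : U + V ≠ 0)
    (h : Quaternion ℝ) :
    (∃ P Q : Quaternion ℝ, P * i * star P = U ∧ Q * i * star Q = V ∧
      h = (1 / 2 : ℝ) • (P * i * star Q + Q * i * star P)) ↔
    ∃ φ : ℝ, h = (Real.cos φ * ‖U + V‖⁻¹) • (U + V)
      - (Real.sin φ * ‖U + V‖⁻¹) • (U * V).im := by
  have hi := aux_sq i hire hinorm
  have hU := aux_sq U hUre hU1
  have hV := aux_sq V hVre hV1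
  have hL : ‖U + V‖ ≠ 0 := norm_ne_zero_iff.mpr hUV
  constructor
  · rintro ⟨P, Q, hP, hQ, rfl⟩
    have nP : ‖P‖ = 1 := by
      have := aux_norm i P U hinorm hP
      nlinarith [norm_nonneg P]
    have nQ : ‖Q‖ = 1 := by
      have := aux_norm i Q V hinorm hQ
      nlinarith [norm_nonneg Q]
    obtain ⟨p1, p2⟩ := aux_unit_mul P nP
    obtain ⟨q1, q2⟩ := aux_unit_mul Q nQ
    rw [aux_half i P Q U hire p2 hP]
    have hW : (P * star Q) * V = U * (P * star Q) := by
      rw [← hP, ← hQ]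
      calc P * star Q * (Q * i * star Q) = P * (star Q * Q) * i * star Q := by noncomm_ring
        _ = P * i * (star P * P) * star Q := by rw [p2, q2]; noncomm_ring
        _ = _ := by noncomm_ring
    obtain ⟨x, z, hxz⟩ := aux_W U V _ hUre hVre hU hV hUV hW
    have hn : ‖P * star Q‖ = 1 := by rw [norm_mul, norm_star, nP, nQ, one_mul]
    rw [hxz, aux_im U V hUre hVre hU]
    rw [hxz, norm_mul] at hn
    have hk := aux_normK U hUre hU1 x z
    have hsum : (x * ‖U + V‖) ^ 2 + (z * ‖U + V‖) ^ 2 = 1 := by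
      have : (‖x • (1 : Quaternion ℝ) + z • U‖ * ‖U + V‖) ^ 2 = 1 := by rw [hn]; norm_num
      rw [mul_pow, hk] at this
      linear_combination this
    let w : ℂ := ⟨-(z * ‖U + V‖), -(x * ‖U + V‖)⟩
    have hw : ‖w‖ = 1 := by
      have : ‖w‖ ^ 2 = 1 := by
        rw [← Complex.normSq_eq_norm_sq, Complex.normSq_apply]
        simp only [w]; linear_combination hsum
      nlinarith [norm_nonneg w]
    refine ⟨w.arg, ?_⟩
    have c1 : Real.cos w.arg = -(z * ‖U + V‖) := by
      have := Complex.norm_mul_cos_arg w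
      rw [hw, one_mul] at this; exact this
    have c2 : Real.sin w.arg = -(x * ‖U + V‖) := by
      have := Complex.norm_mul_sin_arg w
      rw [hw, one_mul] at this; exact this
    rw [c1, c2, sub_eq_add_neg, ← neg_smul]
    congr 2 <;> field_simp
  · rintro ⟨φ, rfl⟩
    obtain ⟨Q, hQ, q1⟩ := aux_root i V hire hi hV
    have nQ := aux_norm_eq Q q1
    obtain ⟨-, q2⟩ := aux_unit_mul Q nQ
    set x := -(Real.sin φ * ‖U + V‖⁻¹) with hx
    set z := -(Real.cos φ * ‖U + V‖⁻¹) with hz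
    set W := (x • (1 : Quaternion ℝ) + z • U) * (U + V) with hWdef
    have hs : (U + V) * V = U * (U + V) := by rw [add_mul, mul_add, hU, hV, add_comm]
    have hW : W * V = U * W := by
      rw [hWdef, mul_assoc, hs, ← mul_assoc, ← mul_assoc]
      congr 1
      simp [add_mul, mul_add]
    have nW : ‖W‖ = 1 := by
      have hk := aux_normK U hUre hU1 x z
      have : ‖W‖ ^ 2 = 1 := by
        rw [hWdef, norm_mul, mul_pow, hk, hx, hz]
        have := Real.sin_sq_add_cos_sq φ
        field_simp
        linear_combination this
      nlinarith [norm_nonneg W]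
    obtain ⟨w1, w2⟩ := aux_unit_mul W nW
    have nP : ‖W * Q‖ = 1 := by rw [norm_mul, nW, nQ, one_mul]
    obtain ⟨p1, p2⟩ := aux_unit_mul _ nP
    have hP : (W * Q) * i * star (W * Q) = U := by
      rw [star_mul]
      calc W * Q * i * (star Q * star W) = W * (Q * i * star Q) * star W := by noncomm_ring
        _ = U := by rw [hQ, hW, mul_assoc, w1, mul_one]
    refine ⟨W * Q, Q, hP, hQ, ?_⟩
    rw [aux_half i (W * Q) Q U hire p2 hP, mul_assoc W, q1, mul_one, hWdef,
      aux_im U V hUre hVre hU, hx, hz, neg_neg, neg_smul, sub_eq_add_neg]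

open Quaternion in
theorem aux_S (U V : Quaternion ℝ) (hUre : U.re = 0) (hVre : V.re = 0)
    (hU1 : ‖U‖ = 1) (hV1 : ‖V‖ = 1) :
    ‖(U * V).im‖ = ‖U + V‖ * Real.sin (Real.arccos (dotQ U V) / 2) := by
  have hu : normSq U = 1 := by rw [Quaternion.normSq_eq_norm_mul_self, hU1]; norm_num
  have hv : normSq V = 1 := by rw [Quaternion.normSq_eq_norm_mul_self, hV1]; norm_num
  have hL : ‖U + V‖ ^ 2 = 2 + 2 * dotQ U V := by
    rw [sq, ← Quaternion.normSq_eq_norm_mul_self]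
    rw [Quaternion.normSq_def'] at hu hv ⊢
    simp [hUre, hVre, dotQ] at hu hv ⊢
    linear_combination hu + hv
  have hM : ‖U - V‖ ^ 2 = 2 - 2 * dotQ U V := by
    rw [sq, ← Quaternion.normSq_eq_norm_mul_self]
    rw [Quaternion.normSq_def'] at hu hv ⊢
    simp [hUre, hVre, dotQ] at hu hv ⊢
    linear_combination hu + hv
  have hS : ‖(U * V).im‖ ^ 2 = 1 - dotQ U V ^ 2 := by
    rw [sq, ← Quaternion.normSq_eq_norm_mul_self]
    rw [Quaternion.normSq_def'] at hu hv ⊢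
    simp [hUre, hVre, dotQ] at hu hv ⊢
    linear_combination (V.imI ^ 2 + V.imJ ^ 2 + V.imK ^ 2) * hu + hv
  have c1 : -1 ≤ dotQ U V := by nlinarith [sq_nonneg ‖U + V‖]
  have c2 : dotQ U V ≤ 1 := by nlinarith [sq_nonneg ‖U - V‖]
  have hc := Real.cos_arccos c1 c2
  set g := Real.arccos (dotQ U V) with hg
  have hs0 : 0 ≤ Real.sin (g / 2) := by
    apply Real.sin_nonneg_of_nonneg_of_le_pi
    · have := Real.arccos_nonneg (dotQ U V); linarith
    · have := Real.arccos_le_pi (dotQ U V); have := Real.pi_pos; linarith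
  have hs : Real.sin (g / 2) ^ 2 = (1 - dotQ U V) / 2 := by
    rw [← hc, Real.sin_sq_eq_half_sub]
    rw [show 2 * (g / 2) = g by ring]; ring
  rw [← sq_eq_sq₀ (norm_nonneg _) (mul_nonneg (norm_nonneg _) hs0), mul_pow, hs, hL, hS]
  ring

/-- rescaling of the square roots -/
theorem aux_scale (i A U : Quaternion ℝ) (s : ℝ) (hs : 0 < s) :
    (s • A) * i * star (s • A) = (s * s) • U ↔ A * i * star A = U := by
  have e : (s • A) * i * star (s • A) = (s * s) • (A * i * star A) := by
    simp [smul_mul_assoc, mul_smul_comm, smul_smul]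
  rw [e]
  constructor
  · intro h; exact smul_right_injective _ (mul_pos hs hs).ne' h
  · rintro rfl; rfl

/-- Let `h_b, h_e` be nonzero (pure) vectors with `h_b × h_e ≠ 0` and angular distance
`γ ∈ (0,π)`, and fix a pure unit vector quaternion `i`.  As `A_b, A_e` range over all
quaternion square roots of `h_b, h_e` w.r.t. `i`, the vector `h_m = A_b ⋆ A_e` traces the
ellipse `h_m(φ) = sqrt(|h_b||h_e|)(b cos φ + sin(γ/2) n sin φ)`, with major semi-axis
`sqrt(|h_b||h_e|) b` and minor semi-axis `sin(γ/2) sqrt(|h_b||h_e|) n`. -/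
theorem stmt_13 (i hb he : Quaternion ℝ) (hire : i.re = 0) (hinorm : ‖i‖ = 1)
    (hbre : hb.re = 0) (here : he.re = 0) (hb0 : hb ≠ 0) (he0 : he ≠ 0)
    (hcross : crossQ hb he ≠ 0) :
    let γ : ℝ := Real.arccos (dotQ hb he / (‖hb‖ * ‖he‖))
    let b : Quaternion ℝ :=
      ‖‖hb‖⁻¹ • hb + ‖he‖⁻¹ • he‖⁻¹ • (‖hb‖⁻¹ • hb + ‖he‖⁻¹ • he)
    let n : Quaternion ℝ := -(‖crossQ hb he‖⁻¹ • crossQ hb he)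
    {h : Quaternion ℝ | ∃ Ab Ae : Quaternion ℝ,
        Ab * i * star Ab = hb ∧ Ae * i * star Ae = he ∧
        h = (1 / 2 : ℝ) • (Ab * i * star Ae + Ae * i * star Ab)} =
      {h : Quaternion ℝ | ∃ φ : ℝ,
        h = Real.sqrt (‖hb‖ * ‖he‖) •
          (Real.cos φ • b + (Real.sin (γ / 2) * Real.sin φ) • n)} := by
  intro γ b n
  have nb : 0 < ‖hb‖ := norm_pos_iff.mpr hb0
  have ne : 0 < ‖he‖ := norm_pos_iff.mpr he0
  set U : Quaternion ℝ := ‖hb‖⁻¹ • hb with hUdef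
  set V : Quaternion ℝ := ‖he‖⁻¹ • he with hVdef
  have eU : hb = ‖hb‖ • U := by rw [hUdef, smul_smul, mul_inv_cancel₀ nb.ne', one_smul]
  have eV : he = ‖he‖ • V := by rw [hVdef, smul_smul, mul_inv_cancel₀ ne.ne', one_smul]
  have hUre : U.re = 0 := by simp [hUdef, hbre]
  have hVre : V.re = 0 := by simp [hVdef, here]
  have hU1 : ‖U‖ = 1 := by rw [hUdef, norm_smul]; simp [nb.ne']
  have hV1 : ‖V‖ = 1 := by rw [hVdef, norm_smul]; simp [ne.ne']
  have hcr : crossQ hb he = (‖hb‖ * ‖he‖) • (U * V).im := by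
    have : hb * he = (‖hb‖ * ‖he‖) • (U * V) := by
      conv_lhs => rw [eU, eV]
      rw [smul_mul_assoc, mul_smul_comm, smul_smul]
    rw [crossQ, this, Quaternion.im_smul]
  have hdot : dotQ hb he / (‖hb‖ * ‖he‖) = dotQ U V := by
    simp only [dotQ, hUdef, hVdef]
    simp
    field_simp
  have hS0 : (U * V).im ≠ 0 := by
    intro h0; apply hcross; rw [hcr, h0, smul_zero]
  have hUV : U + V ≠ 0 := by
    intro h0
    apply hS0
    have : V = -U := (neg_eq_of_add_eq_zero_right h0).symm
    rw [this, mul_neg, aux_sq U hUre hU1, neg_neg]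
    exact Quaternion.im_coe 1
  have hL : ‖U + V‖ ≠ 0 := norm_ne_zero_iff.mpr hUV
  have hSn : ‖(U * V).im‖ ≠ 0 := norm_ne_zero_iff.mpr hS0
  have hS := aux_S U V hUre hVre hU1 hV1
  have hn : n = -(‖(U * V).im‖⁻¹ • (U * V).im) := by
    simp only [n]
    rw [hcr, norm_smul, smul_smul, Real.norm_of_nonneg (mul_pos nb ne).le]
    congr 2
    field_simp
  have hγ : γ = Real.arccos (dotQ U V) := by simp only [γ]; rw [hdot]
  have hell : ∀ φ : ℝ, Real.cos φ • b + (Real.sin (γ / 2) * Real.sin φ) • n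
      = (Real.cos φ * ‖U + V‖⁻¹) • (U + V) - (Real.sin φ * ‖U + V‖⁻¹) • (U * V).im := by
    intro φ
    rw [← hγ] at hS
    have hs0 : Real.sin (γ / 2) ≠ 0 := by
      intro h0; apply hSn; rw [hS, h0, mul_zero]
    rw [hn, smul_neg, ← sub_eq_add_neg, smul_smul, hS]
    simp only [b, smul_smul]
    congr 2
    field_simp
  ext h
  simp only [Set.mem_setOf_eq, hell]
  have sb : 0 < Real.sqrt ‖hb‖ := Real.sqrt_pos.mpr nb
  have se : 0 < Real.sqrt ‖he‖ := Real.sqrt_pos.mpr ne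
  have core := aux_core i U V hire hinorm hUre hVre hU1 hV1 hUV
  have eb : hb = (Real.sqrt ‖hb‖ * Real.sqrt ‖hb‖) • U := by
    rw [Real.mul_self_sqrt nb.le]; exact eU
  have ee : he = (Real.sqrt ‖he‖ * Real.sqrt ‖he‖) • V := by
    rw [Real.mul_self_sqrt ne.le]; exact eV
  have hst : ∀ P Q : Quaternion ℝ,
      (1 / 2 : ℝ) • ((Real.sqrt ‖hb‖ • P) * i * star (Real.sqrt ‖he‖ • Q)
        + (Real.sqrt ‖he‖ • Q) * i * star (Real.sqrt ‖hb‖ • P))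
      = Real.sqrt (‖hb‖ * ‖he‖) • ((1 / 2 : ℝ) • (P * i * star Q + Q * i * star P)) := by
    intro P Q
    rw [Real.sqrt_mul nb.le]
    ext <;> simp <;> ring
  constructor
  · rintro ⟨Ab, Ae, h1, h2, rfl⟩
    have eA : Ab = Real.sqrt ‖hb‖ • ((Real.sqrt ‖hb‖)⁻¹ • Ab) := by
      rw [smul_smul, mul_inv_cancel₀ sb.ne', one_smul]
    have eE : Ae = Real.sqrt ‖he‖ • ((Real.sqrt ‖he‖)⁻¹ • Ae) := by
      rw [smul_smul, mul_inv_cancel₀ se.ne', one_smul]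
    have k1 := (aux_scale i ((Real.sqrt ‖hb‖)⁻¹ • Ab) U _ sb).mp
      (by rw [← eA, ← eb]; exact h1)
    have k2 := (aux_scale i ((Real.sqrt ‖he‖)⁻¹ • Ae) V _ se).mp
      (by rw [← eE, ← ee]; exact h2)
    obtain ⟨φ, hφ⟩ := (core _).mp ⟨_, _, k1, k2, rfl⟩
    refine ⟨φ, ?_⟩
    rw [← hφ, ← hst, ← eA, ← eE]
  · rintro ⟨φ, rfl⟩
    obtain ⟨P, Q, k1, k2, k3⟩ := (core _).mpr ⟨φ, rfl⟩
    refine ⟨Real.sqrt ‖hb‖ • P, Real.sqrt ‖he‖ • Q, ?_, ?_, ?_⟩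
    · exact ((aux_scale i P U _ sb).mpr k1).trans eb.symm
    · exact ((aux_scale i Q V _ se).mpr k2).trans ee.symm
    · rw [k3, hst]
end
end
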